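/- Fix n ≥ 1 and 1 ≤ k ≤ 1+n. For every k-form ω on V = ℝ^{1+n} and every observer U, the energy e(U) := (1/2)( |E_U|² + |B_U|² ) satisfies e(U) = (−1)^{k−1} ( ⟨i_U ω, i_U ω⟩ − (1/2) ⟨ω, ω⟩ η(U,U) ); in other words, T(U,U) = e(U) where T is the energy tensor of ω. -/

import Mathlib

namespace Paper

noncomputable section

/-- The vector space `V = ℝ^{1+n}`. -/
abbrev V (n : ℕ) := Fin (n + 1) → ℝ

/-- The standard basis vectors `e₀, …, e_n`. -/
def eb (n : ℕ) (i : Fin (n + 1)) : V n := Pi.single i 1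

/-- The signs `ε₀ = 1`, `ε_i = -1` for `i ≠ 0`. -/
def eps (n : ℕ) (i : Fin (n + 1)) : ℝ := if i = 0 then 1 else -1

/-- The Minkowski bilinear form `η(x,y) = x₀y₀ − Σᵢ xᵢyᵢ`. -/
def mink (n : ℕ) (x y : V n) : ℝ := ∑ i, eps n i * x i * y i

/-- An observer: a unitary timelike vector oriented to the future. -/
def IsObserver (n : ℕ) (U : V n) : Prop := mink n U U = 1 ∧ 0 < mink n U (eb n 0)

open Classical in
/-- The induced scalar product of two (raw) `k`-forms:
`⟨ω, ω̄⟩ = Σ_{i₁ < ⋯ < i_k} ε_{i₁}⋯ε_{i_k} ω(e_{i₁},…,e_{i_k}) ω̄(e_{i₁},…,e_{i_k})`. -/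
def finner (n k : ℕ) (ω ω' : (Fin k → V n) → ℝ) : ℝ :=
  ∑ v ∈ Finset.univ.filter (fun v : Fin k → Fin (n + 1) => StrictMono v),
    (∏ j, eps n (v j)) * ω (fun j => eb n (v j)) * ω' (fun j => eb n (v j))

/-- Interior product `i_D ω = ω(D, −, …, −)` of a vector with a (raw) `k`-form. -/
def inter (n k : ℕ) (D : V n) (ω : (Fin k → V n) → ℝ) : (Fin (k - 1) → V n) → ℝ :=
  fun v => ω (fun j => if h : (j : ℕ) = 0 then D
    else v ⟨(j : ℕ) - 1, by have := j.isLt; omega⟩)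

/-- The metrically equivalent `1`-form `U* = η(U, −)`. -/
def ustar (n : ℕ) (U : V n) : V n → ℝ := fun w => mink n U w

/-- Wedge product of a `1`-form with a (raw) `k`-form:
`(α ∧ ω)(v₀,…,v_k) = Σ_j (−1)^j α(v_j) ω(v₀,…,v̂_j,…,v_k)`. -/
def wedge1 (n k : ℕ) (α : V n → ℝ) (ω : (Fin k → V n) → ℝ) : (Fin (k + 1) → V n) → ℝ :=
  fun v => ∑ j : Fin (k + 1), (-1 : ℝ) ^ (j : ℕ) * α (v j) * ω (v ∘ j.succAbove)

/-- The electric part `E_U = U* ∧ i_U ω` of a `k`-form with respect to an observer `U`. -/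
def EU (n k : ℕ) (U : V n) (ω : (Fin k → V n) → ℝ) : (Fin (k - 1 + 1) → V n) → ℝ :=
  wedge1 n (k - 1) (ustar n U) (inter n k U ω)

/-- The magnetic part `B_U = i_U (U* ∧ ω)` of a `k`-form with respect to an observer `U`. -/
def BU (n k : ℕ) (U : V n) (ω : (Fin k → V n) → ℝ) : (Fin k → V n) → ℝ :=
  inter n (k + 1) U (wedge1 n k (ustar n U) ω)

/-- Reindexing a raw form along an equality of degrees. -/
def reind (n : ℕ) {m m' : ℕ} (h : m = m') (ω : (Fin m → V n) → ℝ) : (Fin m' → V n) → ℝ :=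
  fun v => ω (fun j => v (Fin.cast h j))

/-- The energy tensor of a `k`-form:
`(−1)^{k−1} T(D₁,D₂) = ⟨i_{D₁}ω, i_{D₂}ω⟩ − (1/2)⟨ω,ω⟩ η(D₁,D₂)`. -/
def energyT (n k : ℕ) (ω : (Fin k → V n) → ℝ) (D₁ D₂ : V n) : ℝ :=
  (-1 : ℝ) ^ (k - 1) * (finner n (k - 1) (inter n k D₁ ω) (inter n k D₂ ω)
    - (1 / 2) * finner n k ω ω * mink n D₁ D₂)

/-- The volume form `dX`, with `dX(e₀,…,e_n) = 1`. -/
def dX (n : ℕ) (u : Fin (n + 1) → V n) : ℝ := Matrix.det (Matrix.of fun i j => u i j)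

/-- The Hodge star of a (raw) `k`-form:
`(*ω)(v₁,…,v_{1+n−k}) = (1/k!) Σ_{i₁,…,i_k} ε_{i₁}⋯ε_{i_k} ω(e_{i₁},…,e_{i_k})
  dX(e_{i₁},…,e_{i_k},v₁,…,v_{1+n−k})`. -/
def hodge (n k : ℕ) (ω : (Fin k → V n) → ℝ) : (Fin (n + 1 - k) → V n) → ℝ :=
  fun v => (1 / (k.factorial : ℝ)) * ∑ i : Fin k → Fin (n + 1),
    (∏ j, eps n (i j)) * ω (fun j => eb n (i j)) *
      dX n (fun l => if h : (l : ℕ) < k then eb n (i ⟨(l : ℕ), h⟩)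
        else v ⟨(l : ℕ) - k, by have := l.isLt; omega⟩)

/-- The bilinear form associated to a matrix `g`. -/
def gbil (n : ℕ) (g : Matrix (Fin (n + 1)) (Fin (n + 1)) ℝ) (x y : V n) : ℝ :=
  ∑ a, ∑ b, g a b * x a * y b

/-- The scalar product of two (raw) `k`-forms with respect to a metric `g` (indices raised
with the inverse matrix `g⁻¹`):
`⟨ω,ω̄⟩_g = (1/k!) Σ g^{i₁j₁}⋯g^{i_kj_k} ω_{i₁…i_k} ω̄_{j₁…j_k}`. -/
def ginner (n : ℕ) (g : Matrix (Fin (n + 1)) (Fin (n + 1)) ℝ) (k : ℕ)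
    (ω ω' : (Fin k → V n) → ℝ) : ℝ :=
  (1 / (k.factorial : ℝ)) * ∑ v : Fin k → Fin (n + 1), ∑ w : Fin k → Fin (n + 1),
    (∏ j, g⁻¹ (v j) (w j)) * ω (fun j => eb n (v j)) * ω' (fun j => eb n (w j))

/-- The energy tensor of a `k`-form with respect to a metric `g`:
`T(g,ω)(D₁,D₂) = (−1)^{k−1}( ⟨i_{D₁}ω, i_{D₂}ω⟩_g − (1/2)⟨ω,ω⟩_g g(D₁,D₂) )`. -/
def energyTg (n : ℕ) (g : Matrix (Fin (n + 1)) (Fin (n + 1)) ℝ) (k : ℕ)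
    (ω : (Fin k → V n) → ℝ) (D₁ D₂ : V n) : ℝ :=
  (-1 : ℝ) ^ (k - 1) * (ginner n g (k - 1) (inter n k D₁ ω) (inter n k D₂ ω)
    - (1 / 2) * ginner n g k ω ω * gbil n g D₁ D₂)

end

end Paper

namespace Paper

open Finset

/-- The sum over all tuples of a function that is invariant under permutations of the tuple and
vanishes on tuples with a repeated entry is `k!` times its sum over increasing tuples. -/
theorem sum_eq_factorial_mul_sum_strictMono {ι : Type*} [Fintype ι] [LinearOrder ι] {k : ℕ}
    [DecidablePred fun v : Fin k → ι => StrictMono v] (F : (Fin k → ι) → ℝ)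
    (hperm : ∀ v (σ : Equiv.Perm (Fin k)), F (v ∘ σ) = F v)
    (hinj : ∀ v, ¬ Function.Injective v → F v = 0) :
    ∑ v, F v = (k.factorial : ℝ) * ∑ v with StrictMono v, F v := by
  classical
  have hsum : ∑ v, F v = ∑ v with Function.Injective v, F v := by
    rw [sum_filter]
    refine sum_congr rfl fun v _ => ?_
    split_ifs with h
    · rfl
    · exact hinj v h
  have hprod : ∑ p ∈ (univ : Finset (Equiv.Perm (Fin k))) ×ˢ
      univ.filter (fun v : Fin k → ι => StrictMono v), F p.2
        = ∑ v with Function.Injective v, F v := by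
    refine sum_bij (fun p _ => p.2 ∘ p.1) ?_ ?_ ?_ ?_
    · rintro ⟨σ, s⟩ h
      simp only [mem_product, mem_filter, mem_univ, true_and] at h ⊢
      exact h.injective.comp σ.injective
    · rintro ⟨σ, s⟩ h ⟨τ, t⟩ h' he
      simp only [mem_product, mem_filter, mem_univ, true_and] at h h' he
      have hst : s = t := by
        rw [← h.range_inj h', ← σ.surjective.range_comp s, he, τ.surjective.range_comp]
      subst hst
      have : σ = τ := Equiv.ext fun i => h.injective (congrFun he i)
      rw [this]
    · intro v hv
      simp only [mem_filter, mem_univ, true_and] at hv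
      refine ⟨((Tuple.sort v)⁻¹, v ∘ Tuple.sort v), ?_, ?_⟩
      · simp only [mem_product, mem_filter, mem_univ, true_and]
        exact (Tuple.monotone_sort v).strictMono_of_injective
          (hv.comp (Tuple.sort v).injective)
      · ext i
        simp
    · rintro ⟨σ, s⟩ _
      exact (hperm s σ).symm
  rw [hsum, ← hprod, sum_product]
  simp [Fintype.card_perm]

/-- For alternating forms, `k!` times the scalar product is the sum over all multi-indices. -/
theorem factorial_mul_finner {n k : ℕ} (ω θ : V n [⋀^Fin k]→ₗ[ℝ] ℝ) :
    (k.factorial : ℝ) * finner n k ω θ =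
      ∑ v : Fin k → Fin (n + 1),
        (∏ j, eps n (v j)) * ω (fun j => eb n (v j)) * θ (fun j => eb n (v j)) := by
  classical
  rw [sum_eq_factorial_mul_sum_strictMono]
  · unfold finner
    congr!
  · intro v σ
    have h (η : V n [⋀^Fin k]→ₗ[ℝ] ℝ) : η (fun j => eb n ((v ∘ σ) j)) =
        ((Equiv.Perm.sign σ : ℤ) : ℝ) * η (fun j => eb n (v j)) := by
      have := η.map_perm (fun j => eb n (v j)) σ
      simpa [Units.smul_def, Function.comp_def] using this
    have hs : ((Equiv.Perm.sign σ : ℤ) : ℝ) * ((Equiv.Perm.sign σ : ℤ) : ℝ) = 1 := by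
      rw [← Int.cast_mul, ← Units.val_mul, Int.units_mul_self]
      simp
    rw [h, h, show ∏ j, eps n ((v ∘ σ) j) = ∏ j, eps n (v j) from
      Equiv.prod_comp σ fun j => eps n (v j)]
    linear_combination (∏ j, eps n (v j)) * ω (fun j => eb n (v j)) *
      θ (fun j => eb n (v j)) * hs
  · intro v hv
    have : ω (fun j => eb n (v j)) = 0 := by
      refine ω.map_eq_zero_of_not_injective _ fun h => hv fun i j hij => h ?_
      simp only [hij]
    simp [this]

/-- The `1`-form `U* = η(U, −)` as a linear map. -/
noncomputable def ustarLinear (n : ℕ) (U : V n) : V n →ₗ[ℝ] ℝ :=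
  ∑ i, (eps n i * U i) • LinearMap.proj i

theorem coe_ustarLinear (n : ℕ) (U : V n) : ⇑(ustarLinear n U) = ustar n U := by
  ext w
  simp [ustarLinear, ustar, mink]

/-- The wedge product of a linear form with an alternating form, as an alternating form. -/
noncomputable def wedgeAlt {n k : ℕ} (α : V n →ₗ[ℝ] ℝ) (ω : V n [⋀^Fin k]→ₗ[ℝ] ℝ) :
    V n [⋀^Fin (k + 1)]→ₗ[ℝ] ℝ :=
  AlternatingMap.alternatizeUncurryFin (α.smulRight ω)

theorem wedgeAlt_apply {n k : ℕ} (α : V n →ₗ[ℝ] ℝ) (ω : V n [⋀^Fin k]→ₗ[ℝ] ℝ)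
    (v : Fin (k + 1) → V n) :
    wedgeAlt α ω v = ∑ j : Fin (k + 1), (-1 : ℝ) ^ (j : ℕ) * α (v j) * ω (j.removeNth v) := by
  simp [wedgeAlt, AlternatingMap.alternatizeUncurryFin_apply, mul_assoc]

theorem coe_wedgeAlt {n k : ℕ} (α : V n →ₗ[ℝ] ℝ) (ω : V n [⋀^Fin k]→ₗ[ℝ] ℝ) :
    ⇑(wedgeAlt α ω) = wedge1 n k α ω := by
  ext v
  exact wedgeAlt_apply α ω v

theorem coe_curryLeft {n k : ℕ} (U : V n) (ω : V n [⋀^Fin (k + 1)]→ₗ[ℝ] ℝ) :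
    ⇑(ω.curryLeft U) = inter n (k + 1) U ω := by
  ext v
  rw [AlternatingMap.curryLeft_apply_apply, inter]
  congr 1
  ext j : 1
  refine Fin.cases ?_ (fun i => ?_) j
  · simp
  · simp

theorem eps_mul_self (n : ℕ) (i : Fin (n + 1)) : eps n i * eps n i = 1 := by
  unfold eps
  split_ifs <;> norm_num

theorem ustarLinear_eb (n : ℕ) (U : V n) (i : Fin (n + 1)) :
    ustarLinear n U (eb n i) = eps n i * U i := by
  simp [ustarLinear, eb, Pi.single_apply]

theorem sum_smul_eb (n : ℕ) (U : V n) : ∑ i, U i • eb n i = U := by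
  ext j
  simp [eb, Pi.single_apply]

/-- Wedging with `U*` is adjoint to the interior product with `U`. -/
theorem finner_wedgeAlt_left {n k : ℕ} (U : V n) (ω : V n [⋀^Fin k]→ₗ[ℝ] ℝ)
    (θ : V n [⋀^Fin (k + 1)]→ₗ[ℝ] ℝ) :
    finner n (k + 1) (wedgeAlt (ustarLinear n U) ω) θ = finner n k ω (θ.curryLeft U) := by
  have hterm (j : Fin (k + 1)) :
      ∑ v : Fin (k + 1) → Fin (n + 1), (∏ l, eps n (v l)) *
        ((-1 : ℝ) ^ (j : ℕ) * ustarLinear n U (eb n (v j)) *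
          ω (j.removeNth fun l => eb n (v l))) * θ (fun l => eb n (v l)) =
      (k.factorial : ℝ) * finner n k ω (θ.curryLeft U) := by
    rw [factorial_mul_finner, ← (Fin.insertNthEquiv (fun _ => Fin (n + 1)) j).sum_comp,
      Fintype.sum_prod_type_right]
    refine sum_congr rfl fun u _ => ?_
    have hU : θ.curryLeft U (fun l => eb n (u l)) =
        ∑ a, U a * θ (Matrix.vecCons (eb n a) fun l => eb n (u l)) := by
      conv_lhs => rw [← sum_smul_eb n U]
      change θ.toMultilinearMap.curryLeft _ _ = _
      rw [map_sum, _root_.sum_apply]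
      simp only [map_smul]
      rfl
    rw [hU, mul_sum]
    refine sum_congr rfl fun a _ => ?_
    have hins : (fun l => eb n (j.insertNth (α := fun _ => Fin (n + 1)) a u l)) =
        j.insertNth (α := fun _ => V n) (eb n a) fun l => eb n (u l) := by
      ext l : 1
      refine Fin.succAboveCases j ?_ (fun i => ?_) l <;> simp
    simp only [Fin.insertNthEquiv_apply, hins, Fin.prod_univ_succAbove _ j,
      Fin.insertNth_apply_same, Fin.insertNth_apply_succAbove, Fin.removeNth_insertNth,
      AlternatingMap.map_insertNth, ustarLinear_eb, zsmul_eq_mul, Int.cast_pow,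
      Int.cast_neg, Int.cast_one]
    have hsign : (-1 : ℝ) ^ (j : ℕ) * (-1 : ℝ) ^ (j : ℕ) = 1 := by
      rw [← mul_pow]
      simp
    generalize θ _ = t
    generalize ω _ = w
    generalize (∏ i, eps n (u i)) = p
    linear_combination (p * w * U a * t) * ((-1 : ℝ) ^ (j : ℕ) * (-1 : ℝ) ^ (j : ℕ)) *
      eps_mul_self n a + (p * w * U a * t) * hsign
  have h := factorial_mul_finner (wedgeAlt (ustarLinear n U) ω) θ
  simp only [wedgeAlt_apply, mul_sum, sum_mul] at h
  rw [sum_comm, sum_congr rfl fun j _ => hterm j] at h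
  simp only [sum_const, card_univ, Fintype.card_fin, nsmul_eq_mul, Nat.factorial_succ,
    Nat.cast_mul] at h
  have h1 : ((k + 1 : ℕ) : ℝ) ≠ 0 := by positivity
  have h2 : (k.factorial : ℝ) ≠ 0 := by positivity
  rw [mul_assoc] at h
  exact mul_left_cancel₀ h2 (mul_left_cancel₀ h1 h)

/-- The interior product is an antiderivation: `i_U (α ∧ ω) = α(U) ω − α ∧ i_U ω`. -/
theorem curryLeft_wedgeAlt {n k : ℕ} (α : V n →ₗ[ℝ] ℝ) (U : V n)
    (ω : V n [⋀^Fin (k + 1)]→ₗ[ℝ] ℝ) :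
    (wedgeAlt α ω).curryLeft U = α U • ω - wedgeAlt α (ω.curryLeft U) := by
  ext v
  rw [AlternatingMap.curryLeft_apply_apply, wedgeAlt_apply, Fin.sum_univ_succ,
    AlternatingMap.sub_apply, AlternatingMap.smul_apply, wedgeAlt_apply, sub_eq_add_neg,
    ← sum_neg_distrib]
  congr 1
  · simp [Matrix.vecCons]
  · refine sum_congr rfl fun j _ => ?_
    have : j.succ.removeNth (Matrix.vecCons U v) = Matrix.vecCons U (j.removeNth v) := by
      ext l : 1
      refine Fin.cases ?_ (fun i => ?_) l <;> simp [Fin.removeNth]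
    rw [this, AlternatingMap.curryLeft_apply_apply]
    simp [pow_succ]

theorem finner_comm (n k : ℕ) (ω θ : (Fin k → V n) → ℝ) : finner n k ω θ = finner n k θ ω :=
  sum_congr rfl fun _ _ => by ring

theorem finner_smul_sub_right (n k : ℕ) (c : ℝ) (ω θ ξ : V n [⋀^Fin k]→ₗ[ℝ] ℝ) :
    finner n k ω ⇑(c • θ - ξ) = c * finner n k ω θ - finner n k ω ξ := by
  unfold finner
  rw [mul_sum, ← sum_sub_distrib]
  refine sum_congr rfl fun v _ => ?_
  simp only [AlternatingMap.sub_apply, AlternatingMap.smul_apply, smul_eq_mul]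
  ring

/-- `⟨U* ∧ ω, U* ∧ ω⟩ = η(U,U) ⟨ω, ω⟩ − ⟨i_U ω, i_U ω⟩`. -/
theorem finner_wedge1_ustar {n k : ℕ} (U : V n) (ω : V n [⋀^Fin (k + 1)]→ₗ[ℝ] ℝ) :
    finner n (k + 1 + 1) (wedge1 n (k + 1) (ustar n U) ω) (wedge1 n (k + 1) (ustar n U) ω) =
      mink n U U * finner n (k + 1) ω ω -
        finner n (k + 1 - 1) (inter n (k + 1) U ω) (inter n (k + 1) U ω) := by
  rw [← coe_ustarLinear, ← coe_wedgeAlt, finner_wedgeAlt_left, curryLeft_wedgeAlt,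
    finner_smul_sub_right, finner_comm n (k + 1) ω (wedgeAlt _ _), finner_wedgeAlt_left,
    ← coe_curryLeft, coe_ustarLinear]
  rfl

/-- the energy `e(U) = (1/2)(|E_U|² + |B_U|²)` equals
`(−1)^{k−1}(⟨i_Uω,i_Uω⟩ − (1/2)⟨ω,ω⟩η(U,U))`, i.e. `T(U,U) = e(U)`. -/
theorem statement10 (n k : ℕ) (hn : 1 ≤ n) (hk1 : 1 ≤ k) (hk2 : k ≤ n + 1)
    (ω : AlternatingMap ℝ (V n) ℝ (Fin k)) (U : V n) (hU : IsObserver n U) :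
    (1 / 2) * (((-1 : ℝ) ^ (k - 1) * finner n (k - 1) (inter n k U ⇑ω) (inter n k U ⇑ω))
        + ((-1 : ℝ) ^ k *
            finner n (k + 1) (wedge1 n k (ustar n U) ⇑ω) (wedge1 n k (ustar n U) ⇑ω)))
      = (-1 : ℝ) ^ (k - 1) * (finner n (k - 1) (inter n k U ⇑ω) (inter n k U ⇑ω)
          - (1 / 2) * finner n k ⇑ω ⇑ω * mink n U U) ∧
    energyT n k ⇑ω U U
      = (1 / 2) * (((-1 : ℝ) ^ (k - 1) * finner n (k - 1) (inter n k U ⇑ω) (inter n k U ⇑ω))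
        + ((-1 : ℝ) ^ k *
            finner n (k + 1) (wedge1 n k (ustar n U) ⇑ω) (wedge1 n k (ustar n U) ⇑ω))) := by
  obtain ⟨m, rfl⟩ : ∃ m, k = m + 1 := ⟨k - 1, by omega⟩
  have h := finner_wedge1_ustar U ω
  rw [energyT, h]
  simp only [pow_succ]
  simp only [Nat.add_sub_cancel (n := m) (m := 1)]
  constructor <;> ring

end Paper
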